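/- For every test function θ : ℚ_p → ℝ with ∫_{ℚ_p} θ dμ = 0, one has ∫_{ℚ_p} (f₁ ⋆ J_{L,m}) θ dμ → ∫_{ℚ_p} (f₁ ⋆ J_L) θ dμ as |m|_p → ∞: for every ε > 0 there exists M > 0 such that for every m ∈ ℚ_p with |m|_p ≥ M, |∫_{ℚ_p} (f₁ ⋆ J_{L,m}) θ dμ − ∫_{ℚ_p} (f₁ ⋆ J_L) θ dμ| < ε. (That is, the solutions φ_{L,m} = f₁ ⋆ J_{L,m} of the Vladimirov equation D φ_{L,m} = J_{L,m} converge to f₁ ⋆ J_L in the weak topology of Lizorkin distributions.) -/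

import Mathlib

open MeasureTheory

/-- A (Bruhat–Schwartz) test function on `ℚ_[p]`: locally constant with compact support. -/
def IsTestFunction {p : ℕ} [Fact p.Prime] (φ : ℚ_[p] → ℝ) : Prop :=
  (∀ x : ℚ_[p], ∃ l : ℤ, ∀ x' : ℚ_[p], ‖x'‖ ≤ (p : ℝ) ^ (-l) → φ (x + x') = φ x) ∧
  HasCompactSupport φ

/-- `δ_L`: `p^L` times the indicator of the ball `{x : |x|_p ≤ p^{-L}}`. -/
noncomputable def deltaL (p : ℕ) [Fact p.Prime] (L : ℕ) (x : ℚ_[p]) : ℝ :=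
  if ‖x‖ ≤ (p : ℝ) ^ (-(L : ℤ)) then (p : ℝ) ^ L else 0

/-- `J_L(x) = Σ_j v_j δ_L(x − x_j)`. -/
noncomputable def JL (p : ℕ) [Fact p.Prime] (L : ℕ) {N : ℕ} (v : Fin N → ℝ)
    (xs : Fin N → ℚ_[p]) (x : ℚ_[p]) : ℝ :=
  ∑ j, v j * deltaL p L (x - xs j)

/-- `Ω_m`: `|m|_p^{-1}` times the indicator of the ball `{x : |x|_p ≤ |m|_p}`. -/
noncomputable def OmegaM (p : ℕ) [Fact p.Prime] (m : ℚ_[p]) (x : ℚ_[p]) : ℝ :=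
  if ‖x‖ ≤ ‖m‖ then ‖m‖⁻¹ else 0

/-- `J_{L,m}(x) = J_L(x) − Σ_j v_j (Ω_m ⋆ δ_L(· − x_j))(x)`. -/
noncomputable def JLm (p : ℕ) [Fact p.Prime] [MeasurableSpace ℚ_[p]]
    (μ : Measure ℚ_[p]) (L : ℕ) {N : ℕ} (v : Fin N → ℝ) (xs : Fin N → ℚ_[p])
    (m : ℚ_[p]) (x : ℚ_[p]) : ℝ :=
  JL p L v xs x - ∑ j, v j * ∫ y, OmegaM p m (x - y) * deltaL p L (y - xs j) ∂μ

/-- `(f₁ ⋆ g)(x) = −((p−1)/(p ln p)) ∫ ln|x − y|_p g(y) dμ(y)`. -/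
noncomputable def f1conv (p : ℕ) [Fact p.Prime] [MeasurableSpace ℚ_[p]]
    (μ : Measure ℚ_[p]) (g : ℚ_[p] → ℝ) (x : ℚ_[p]) : ℝ :=
  -(((p : ℝ) - 1) / ((p : ℝ) * Real.log p)) * ∫ y, Real.log ‖x - y‖ * g y ∂μ

open Metric

/-- Adding a constant to a function does not change its pairing with an integrable function of
vanishing integral; the pairing need not converge. -/
lemma integral_add_const_mul_eq {α : Type*} [MeasurableSpace α] {ν : Measure α} {f θ : α → ℝ}
    (hθ : Integrable θ ν) (hθ0 : ∫ x, θ x ∂ν = 0) (C : ℝ) :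
    ∫ x, (f x + C) * θ x ∂ν = ∫ x, f x * θ x ∂ν := by
  simp_rw [add_mul]
  by_cases hf : Integrable (fun x => f x * θ x) ν
  · rw [integral_add hf (hθ.const_mul C), integral_const_mul, hθ0, mul_zero, add_zero]
  · rw [integral_undef hf, integral_undef]
    exact fun h => hf (((integrable_add_iff_integrable_left (hθ.const_mul C))).1 h)

section

variable {p : ℕ} [Fact p.Prime]

lemma norm_sub_le_iff_of_norm_le {x a : ℚ_[p]} {r : ℝ} (ha : ‖a‖ ≤ r) :
    ‖x - a‖ ≤ r ↔ ‖x‖ ≤ r := by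
  constructor <;> intro h
  · have := IsUltrametricDist.norm_add_le_max (x - a) a
    rw [sub_add_cancel] at this
    exact this.trans (max_le h ha)
  · have := IsUltrametricDist.norm_add_le_max x (-a)
    rw [← sub_eq_add_neg, norm_neg] at this
    exact this.trans (max_le h ha)

lemma OmegaM_sub_of_norm_le {m a : ℚ_[p]} (x : ℚ_[p]) (ha : ‖a‖ ≤ ‖m‖) :
    OmegaM p m (x - a) = OmegaM p m x := by
  simp only [OmegaM, norm_sub_le_iff_of_norm_le ha]

lemma OmegaM_neg (m x : ℚ_[p]) : OmegaM p m (-x) = OmegaM p m x := by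
  simp only [OmegaM, norm_neg]

lemma enorm_log_norm_le_tsum {y : ℚ_[p]} (hy : ‖y‖ ≤ 1) :
    ‖Real.log ‖y‖‖ₑ ≤ ∑' n : ℕ, (closedBall (0 : ℚ_[p]) ((p : ℝ) ^ (-(n : ℤ)))).indicator
      (fun _ => ENNReal.ofReal (Real.log p)) y := by
  have hp : (1 : ℝ) < p := by exact_mod_cast (Fact.out : p.Prime).one_lt
  rcases eq_or_ne y 0 with rfl | h0
  · simp
  have hyv := Padic.norm_eq_zpow_neg_valuation h0
  have hv : 0 ≤ y.valuation := by
    rw [hyv, zpow_le_one_iff_right₀ hp] at hy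
    omega
  obtain ⟨k, hk⟩ := Int.eq_ofNat_of_zero_le hv
  rw [hk] at hyv
  have hlog : ‖Real.log ‖y‖‖ = k * Real.log p := by
    rw [hyv, Real.log_zpow, Real.norm_eq_abs]
    push_cast
    rw [neg_mul, abs_neg, abs_of_nonneg (mul_nonneg k.cast_nonneg (Real.log_nonneg hp.le))]
  calc ‖Real.log ‖y‖‖ₑ = ∑ n ∈ Finset.range k, ENNReal.ofReal (Real.log p) := by
        rw [← ofReal_norm, hlog, ENNReal.ofReal_mul k.cast_nonneg]
        simp
    _ = ∑ n ∈ Finset.range k, (closedBall (0 : ℚ_[p]) ((p : ℝ) ^ (-(n : ℤ)))).indicator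
          (fun _ => ENNReal.ofReal (Real.log p)) y := by
        refine Finset.sum_congr rfl fun n hn => ?_
        rw [Set.indicator_of_mem]
        rw [mem_closedBall, dist_eq_norm, sub_zero, hyv]
        have := Finset.mem_range.1 hn
        exact zpow_le_zpow_right₀ hp.le (by omega)
    _ ≤ _ := ENNReal.sum_le_tsum _

lemma norm_JL_le (L : ℕ) {N : ℕ} (v : Fin N → ℝ) (xs : Fin N → ℚ_[p]) (y : ℚ_[p]) :
    ‖JL p L v xs y‖ ≤ ∑ j, ‖v j‖ * (p : ℝ) ^ L := by
  refine norm_sum_le_of_le _ fun j _ => ?_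
  rw [norm_mul]
  refine mul_le_mul_of_nonneg_left ?_ (norm_nonneg _)
  unfold deltaL
  split_ifs
  · rw [Real.norm_of_nonneg (by positivity)]
  · rw [norm_zero]
    positivity

lemma OmegaM_mul_JL (L : ℕ) {N : ℕ} (v : Fin N → ℝ) (xs : Fin N → ℚ_[p])
    {m : ℚ_[p]} (hm : 1 ≤ ‖m‖) (hxm : ∀ j, ‖xs j‖ ≤ ‖m‖) (y : ℚ_[p]) :
    OmegaM p m y * (‖m‖ * JL p L v xs y) = JL p L v xs y := by
  have hp : (1 : ℝ) < p := by exact_mod_cast (Fact.out : p.Prime).one_lt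
  by_cases hy : ‖y‖ ≤ ‖m‖
  · rw [OmegaM, if_pos hy, ← mul_assoc, inv_mul_cancel₀ (by linarith), one_mul]
  · have h0 : JL p L v xs y = 0 := by
      refine Finset.sum_eq_zero fun j _ => ?_
      have h1 : (p : ℝ) ^ (-(L : ℤ)) ≤ 1 := zpow_le_one_of_nonpos₀ hp.le (by omega)
      rw [deltaL, if_neg, mul_zero]
      exact fun h => hy ((norm_sub_le_iff_of_norm_le (hxm j)).1 (h.trans (h1.trans hm)))
    rw [h0, mul_zero, mul_zero]

lemma IsTestFunction.continuous {φ : ℚ_[p] → ℝ} (hφ : IsTestFunction φ) :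
    Continuous φ := by
  have hp : (0 : ℝ) < p := by exact_mod_cast (Fact.out : p.Prime).pos
  refine (IsLocallyConstant.iff_eventually_eq φ).2 (fun x => ?_) |>.continuous
  obtain ⟨l, hl⟩ := hφ.1 x
  filter_upwards [closedBall_mem_nhds x (zpow_pos hp (-l))] with y hy
  rw [← hl (y - x) (by rwa [← dist_eq_norm]), add_sub_cancel]

variable [MeasurableSpace ℚ_[p]] [BorelSpace ℚ_[p]] (μ : Measure ℚ_[p])

/-- Shrinking a ball by a factor `p` at least halves its Haar measure. -/
lemma two_mul_measure_closedBall_succ_le [μ.IsAddHaarMeasure] (n : ℕ) :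
    2 * μ (closedBall (0 : ℚ_[p]) ((p : ℝ) ^ (-((n + 1 : ℕ) : ℤ)))) ≤
      μ (closedBall (0 : ℚ_[p]) ((p : ℝ) ^ (-(n : ℤ)))) := by
  have hp : (1 : ℝ) < p := by exact_mod_cast (Fact.out : p.Prime).one_lt
  set s := (p : ℝ) ^ (-((n + 1 : ℕ) : ℤ)) with hs
  set r := (p : ℝ) ^ (-(n : ℤ)) with hr
  have hsr : s < r := zpow_lt_zpow_right₀ hp (by push_cast; omega)
  set c : ℚ_[p] := (p : ℚ_[p]) ^ (n : ℤ) with hc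
  have hcn : ‖c‖ = r := by rw [hc, Padic.norm_p_zpow]
  have hdisj : Disjoint (closedBall (0 : ℚ_[p]) s) (closedBall c s) := by
    rw [Set.disjoint_left]
    intro x hx hx'
    rw [mem_closedBall, dist_eq_norm, sub_zero] at hx
    rw [mem_closedBall, dist_comm, dist_eq_norm, norm_sub_le_iff_of_norm_le hx] at hx'
    linarith
  have hsub : closedBall (0 : ℚ_[p]) s ∪ closedBall c s ⊆ closedBall 0 r := by
    apply Set.union_subset (closedBall_subset_closedBall hsr.le)
    intro x hx
    rw [mem_closedBall, dist_eq_norm] at hx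
    rw [mem_closedBall, dist_eq_norm, sub_zero]
    exact (norm_sub_le_iff_of_norm_le hcn.le).1 (hx.trans hsr.le)
  calc 2 * μ (closedBall (0 : ℚ_[p]) s)
      = μ (closedBall (0 : ℚ_[p]) s) + μ (closedBall c s) := by
        rw [Measure.addHaar_closedBall_center μ c, two_mul]
    _ = μ (closedBall (0 : ℚ_[p]) s ∪ closedBall c s) :=
        (measure_union hdisj measurableSet_closedBall).symm
    _ ≤ _ := measure_mono hsub

lemma tsum_measure_closedBall_ne_top [μ.IsAddHaarMeasure] :
    ∑' n : ℕ, μ (closedBall (0 : ℚ_[p]) ((p : ℝ) ^ (-(n : ℤ)))) ≠ ⊤ := by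
  have key (n : ℕ) : μ (closedBall (0 : ℚ_[p]) ((p : ℝ) ^ (-(n : ℤ)))) ≤
      (2⁻¹ : ENNReal) ^ n * μ (closedBall (0 : ℚ_[p]) 1) := by
    induction n with
    | zero => simp
    | succ n ih =>
      have h := (two_mul_measure_closedBall_succ_le μ n).trans ih
      rw [mul_comm, ← ENNReal.le_div_iff_mul_le (by simp) (by simp)] at h
      refine h.trans_eq ?_
      rw [ENNReal.div_eq_inv_mul, ← mul_assoc, pow_succ']
  refine ne_top_of_le_ne_top ?_ (ENNReal.tsum_le_tsum key)
  rw [ENNReal.tsum_mul_right, ENNReal.tsum_geometric]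
  refine ENNReal.mul_ne_top ?_ (isCompact_closedBall _ _).measure_lt_top.ne
  simp [ENNReal.one_sub_inv_two]

lemma integrable_log_norm_mul_OmegaM [μ.IsAddHaarMeasure] {m : ℚ_[p]} (hm : 1 ≤ ‖m‖) :
    Integrable (fun y => Real.log ‖y‖ * OmegaM p m y) μ := by
  have hmeas : Measurable (OmegaM p m) :=
    Measurable.ite (measurableSet_le measurable_norm measurable_const)
      measurable_const measurable_const
  refine ⟨((Real.measurable_log.comp measurable_norm).mul hmeas).aestronglyMeasurable, ?_⟩
  set S : ℚ_[p] → ENNReal := fun y => ∑' n : ℕ,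
    (closedBall (0 : ℚ_[p]) ((p : ℝ) ^ (-(n : ℤ)))).indicator
      (fun _ => ENNReal.ofReal (Real.log p)) y with hS
  have hSint : ∫⁻ y, S y ∂μ ≠ ⊤ := by
    rw [hS, lintegral_tsum fun n =>
      (measurable_const.indicator measurableSet_closedBall).aemeasurable]
    simp_rw [lintegral_indicator_const measurableSet_closedBall]
    rw [ENNReal.tsum_mul_left]
    exact ENNReal.mul_ne_top ENNReal.ofReal_ne_top (tsum_measure_closedBall_ne_top μ)
  have hbound (y : ℚ_[p]) : ‖Real.log ‖y‖ * OmegaM p m y‖ₑ ≤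
      (closedBall (0 : ℚ_[p]) ‖m‖).indicator (fun _ => ENNReal.ofReal (Real.log ‖m‖)) y
        + S y := by
    by_cases hy : ‖y‖ ≤ ‖m‖
    · have hΩ : ‖OmegaM p m y‖ₑ ≤ 1 := by
        rw [OmegaM, if_pos hy, ← ofReal_norm, norm_inv, norm_norm]
        exact ENNReal.ofReal_le_one.2 (inv_le_one_of_one_le₀ hm)
      rw [enorm_mul]
      refine (mul_le_of_le_one_right' hΩ).trans ?_
      rcases le_total ‖y‖ 1 with h1 | h1
      · exact (enorm_log_norm_le_tsum h1).trans le_add_self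
      · refine le_add_right ?_
        rw [Set.indicator_of_mem (by simpa using hy), ← ofReal_norm,
          Real.norm_of_nonneg (Real.log_nonneg h1)]
        exact ENNReal.ofReal_le_ofReal (Real.log_le_log (by linarith) hy)
    · simp [OmegaM, hy]
  refine (lintegral_mono hbound).trans_lt ?_
  rw [lintegral_add_left (measurable_const.indicator measurableSet_closedBall),
    lintegral_indicator_const measurableSet_closedBall]
  exact ENNReal.add_lt_top.2 ⟨ENNReal.mul_lt_top ENNReal.ofReal_lt_top
    (isCompact_closedBall _ _).measure_lt_top, hSint.lt_top⟩

lemma JLm_eq_sub_mul_OmegaM [μ.IsAddHaarMeasure] (L : ℕ) {N : ℕ} (v : Fin N → ℝ)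
    (xs : Fin N → ℚ_[p]) {m : ℚ_[p]} (hm : 1 ≤ ‖m‖) (hxm : ∀ j, ‖xs j‖ ≤ ‖m‖) (x : ℚ_[p]) :
    JLm p μ L v xs m x =
      JL p L v xs x - (∑ j, v j * ∫ y, deltaL p L y ∂μ) * OmegaM p m x := by
  have hp : (1 : ℝ) < p := by exact_mod_cast (Fact.out : p.Prime).one_lt
  rw [JLm, Finset.sum_mul]
  congr 1
  refine Finset.sum_congr rfl fun j _ => ?_
  rw [mul_assoc]
  congr 1
  rw [← integral_sub_right_eq_self (deltaL p L) (xs j), mul_comm, ← integral_const_mul]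
  refine integral_congr_ae (.of_forall fun y => ?_)
  by_cases hy : ‖y - xs j‖ ≤ (p : ℝ) ^ (-(L : ℤ))
  · have h1 : (p : ℝ) ^ (-(L : ℤ)) ≤ 1 := zpow_le_one_of_nonpos₀ hp.le (by omega)
    have hy' : ‖y‖ ≤ ‖m‖ := (norm_sub_le_iff_of_norm_le (hxm j)).1 (hy.trans (h1.trans hm))
    simp only [OmegaM_sub_of_norm_le x hy']
  · simp only [deltaL, if_neg hy, mul_zero]

lemma integral_log_norm_sub_mul_OmegaM [μ.IsAddHaarMeasure] {m x : ℚ_[p]} (hx : ‖x‖ ≤ ‖m‖) :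
    ∫ y, Real.log ‖x - y‖ * OmegaM p m y ∂μ = ∫ y, Real.log ‖y‖ * OmegaM p m y ∂μ := by
  rw [← integral_sub_left_eq_self (fun y => Real.log ‖y‖ * OmegaM p m y) μ x]
  refine integral_congr_ae (.of_forall fun y => ?_)
  simp only
  rw [← OmegaM_neg m (x - y), neg_sub, OmegaM_sub_of_norm_le y hx]

lemma integrable_log_norm_sub_mul_OmegaM [μ.IsAddHaarMeasure] {m x : ℚ_[p]} (hm : 1 ≤ ‖m‖)
    (hx : ‖x‖ ≤ ‖m‖) : Integrable (fun y => Real.log ‖x - y‖ * OmegaM p m y) μ := by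
  refine ((integrable_log_norm_mul_OmegaM μ hm).comp_sub_left x).congr (.of_forall fun y => ?_)
  simp only
  rw [← OmegaM_neg m (x - y), neg_sub, OmegaM_sub_of_norm_le y hx]

lemma measurable_deltaL (L : ℕ) : Measurable (deltaL p L) :=
  Measurable.ite (measurableSet_le measurable_norm measurable_const)
    measurable_const measurable_const

lemma measurable_JL (L : ℕ) {N : ℕ} (v : Fin N → ℝ) (xs : Fin N → ℚ_[p]) :
    Measurable (JL p L v xs) := by
  unfold JL
  exact Finset.measurable_sum _ fun j _ =>
    ((measurable_deltaL L).comp (continuous_sub_right (xs j)).measurable).const_mul _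

lemma integrable_log_norm_sub_mul_JL [μ.IsAddHaarMeasure] (L : ℕ) {N : ℕ} (v : Fin N → ℝ)
    (xs : Fin N → ℚ_[p]) {m x : ℚ_[p]} (hm : 1 ≤ ‖m‖) (hxm : ∀ j, ‖xs j‖ ≤ ‖m‖)
    (hx : ‖x‖ ≤ ‖m‖) : Integrable (fun y => Real.log ‖x - y‖ * JL p L v xs y) μ := by
  have hb (y : ℚ_[p]) : ‖‖m‖ * JL p L v xs y‖ ≤ ‖m‖ * ∑ j, ‖v j‖ * (p : ℝ) ^ L := by
    rw [norm_mul, norm_norm]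
    exact mul_le_mul_of_nonneg_left (norm_JL_le L v xs y) (norm_nonneg _)
  refine ((integrable_log_norm_sub_mul_OmegaM μ hm hx).mul_bdd
    ((measurable_JL L v xs).const_mul ‖m‖).aestronglyMeasurable (.of_forall hb)).congr
    (.of_forall fun y => ?_)
  simp only
  rw [mul_assoc, OmegaM_mul_JL L v xs hm hxm]

/-- Near the origin, regularizing the source shifts the potential by a constant. -/
lemma exists_f1conv_JLm_eq_add_const [μ.IsAddHaarMeasure] (L : ℕ) {N : ℕ} (v : Fin N → ℝ)
    (xs : Fin N → ℚ_[p]) {m : ℚ_[p]} (hm : 1 ≤ ‖m‖) (hxm : ∀ j, ‖xs j‖ ≤ ‖m‖) :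
    ∃ C : ℝ, ∀ x : ℚ_[p], ‖x‖ ≤ ‖m‖ →
      f1conv p μ (JLm p μ L v xs m) x = f1conv p μ (JL p L v xs) x + C := by
  refine ⟨((p : ℝ) - 1) / ((p : ℝ) * Real.log p) * ((∑ j, v j * ∫ y, deltaL p L y ∂μ) *
    ∫ y, Real.log ‖y‖ * OmegaM p m y ∂μ), fun x hx => ?_⟩
  have h : ∫ y, Real.log ‖x - y‖ * JLm p μ L v xs m y ∂μ =
      (∫ y, Real.log ‖x - y‖ * JL p L v xs y ∂μ) - (∑ j, v j * ∫ y, deltaL p L y ∂μ) *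
        ∫ y, Real.log ‖y‖ * OmegaM p m y ∂μ := by
    rw [← integral_log_norm_sub_mul_OmegaM μ hx, ← integral_const_mul, ← integral_sub
      (integrable_log_norm_sub_mul_JL μ L v xs hm hxm hx)
      ((integrable_log_norm_sub_mul_OmegaM μ hm hx).const_mul _)]
    refine integral_congr_ae (.of_forall fun y => ?_)
    simp only
    rw [JLm_eq_sub_mul_OmegaM μ L v xs hm hxm]
    ring
  rw [f1conv, f1conv, h]
  ring

end


theorem stmt9 {p : ℕ} [Fact p.Prime] [MeasurableSpace ℚ_[p]] [BorelSpace ℚ_[p]]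
    (μ : Measure ℚ_[p]) [μ.IsAddHaarMeasure]
    (hμ : μ {x : ℚ_[p] | ‖x‖ ≤ 1} = 1)
    (L : ℕ) (hL : 0 < L) {N : ℕ} (v : Fin N → ℝ) (xs : Fin N → ℚ_[p])
    (hxs : Function.Injective xs)
    (θ : ℚ_[p] → ℝ) (hθ : IsTestFunction θ) (hθ0 : ∫ x, θ x ∂μ = 0) :
    ∀ ε > (0 : ℝ), ∃ M > (0 : ℝ), ∀ m : ℚ_[p], M ≤ ‖m‖ →
      |(∫ x, f1conv p μ (JLm p μ L v xs m) x * θ x ∂μ) -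
        ∫ x, f1conv p μ (JL p L v xs) x * θ x ∂μ| < ε := by
  obtain ⟨R, hR⟩ := hθ.2.isCompact.isBounded.exists_norm_le
  intro ε hε
  have hS : 0 ≤ ∑ j, ‖xs j‖ := Finset.sum_nonneg fun j _ => norm_nonneg _
  refine ⟨1 + |R| + ∑ j, ‖xs j‖, by positivity, fun m hM => ?_⟩
  have hR0 := abs_nonneg R
  have hxm (j : Fin N) : ‖xs j‖ ≤ ‖m‖ := by
    have := Finset.single_le_sum (fun j _ => norm_nonneg (xs j)) (Finset.mem_univ j)
    linarith
  obtain ⟨C, hC⟩ := exists_f1conv_JLm_eq_add_const μ L v xs (by linarith) hxm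
  have key : ∫ x, f1conv p μ (JLm p μ L v xs m) x * θ x ∂μ =
      ∫ x, f1conv p μ (JL p L v xs) x * θ x ∂μ := by
    rw [← integral_add_const_mul_eq (f := f1conv p μ (JL p L v xs))
      (hθ.continuous.integrable_of_hasCompactSupport hθ.2) hθ0 C]
    refine integral_congr_ae (.of_forall fun x => ?_)
    by_cases hx : θ x = 0
    · simp [hx]
    · have := hR x (subset_tsupport θ hx)
      have := le_abs_self R
      simp only [hC x (by linarith)]
  rwa [key, sub_self, abs_zero]
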